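/- For every integer k ≥ 1 and every dimension d ≥ 2, α_{k,d} ≥ α_{k,d+1}; that is, the optimal constants are monotonically non-increasing in the dimension. -/

import Mathlib

open MeasureTheory Real Filter

noncomputable section

/-- Euclidean space `ℝ^d`. -/
abbrev Euc (d : ℕ) := EuclideanSpace ℝ (Fin d)

/-- The Rayleigh quotient of a function `u` on a set `Ω ⊆ ℝ^d`. -/
noncomputable def rayleigh {d : ℕ} (Ω : Set (Euc d)) (u : Euc d → ℝ) : ℝ :=
  (∫ x in Ω, ‖fderiv ℝ u x‖ ^ 2) / (∫ x in Ω, (u x) ^ 2)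

/-- The `k`-th Neumann eigenvalue of `Ω ⊆ ℝ^d`, defined by the variational (min-max)
principle: the infimum, over all subspaces `V` of smooth functions `ℝ^d → ℝ` whose space of
restrictions to `Ω` is `(k+1)`-dimensional, of the supremum of the Rayleigh quotient over
the elements of `V` that are nonzero in `L²(Ω)`. -/
noncomputable def neumannEigenvalue {d : ℕ} (k : ℕ) (Ω : Set (Euc d)) : ℝ :=
  sInf { t : ℝ | ∃ V : Submodule ℝ (Euc d → ℝ),
    (∀ u ∈ V, ContDiff ℝ (⊤ : ℕ∞) u) ∧
    Module.finrank ℝ (V.map (LinearMap.funLeft ℝ ℝ ((↑) : Ω → Euc d))) = k + 1 ∧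
    t = sSup { r : ℝ | ∃ u ∈ V, (0 < ∫ x in Ω, (u x) ^ 2) ∧ r = rayleigh Ω u } }

/-- A nonempty bounded convex open subset of `ℝ^d`. -/
def IsConvexDomain {d : ℕ} (Ω : Set (Euc d)) : Prop :=
  Ω.Nonempty ∧ IsOpen Ω ∧ Bornology.IsBounded Ω ∧ Convex ℝ Ω

/-- The optimal constant `α_{k,d}`: the infimum of `μ_k(Ω₁)/μ_k(Ω₂)` over all pairs of
nonempty bounded convex open sets `Ω₁ ⊆ Ω₂ ⊂ ℝ^d`. -/
noncomputable def alphaConst (k d : ℕ) : ℝ :=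
  sInf { r : ℝ | ∃ Ω₁ Ω₂ : Set (Euc d), IsConvexDomain Ω₁ ∧ IsConvexDomain Ω₂ ∧ Ω₁ ⊆ Ω₂ ∧
    r = neumannEigenvalue k Ω₁ / neumannEigenvalue k Ω₂ }

/-- The Bessel function of the first kind of order `ν` (for `x > 0`). -/
noncomputable def besselJ (ν : ℝ) (x : ℝ) : ℝ :=
  ∑' m : ℕ, ((-1 : ℝ) ^ m / (m.factorial * Real.Gamma (m + ν + 1))) * (x / 2) ^ (2 * (m : ℝ) + ν)

/-- The first positive zero `j_{ν,1}` of the Bessel function `J_ν`. -/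
noncomputable def besselZero1 (ν : ℝ) : ℝ :=
  sInf {x : ℝ | 0 < x ∧ besselJ ν x = 0}

/-- The second positive zero `j_{ν,2}` of the Bessel function `J_ν`. -/
noncomputable def besselZero2 (ν : ℝ) : ℝ :=
  sInf {x : ℝ | besselZero1 ν < x ∧ besselJ ν x = 0}


lemma cs_interval (f : ℝ → ℝ) (hf : Continuous f) (a b : ℝ) (hab : a ≤ b) :
    (∫ s in a..b, f s) ^ 2 ≤ (b - a) * ∫ s in a..b, f s ^ 2 := by
  rcases hab.eq_or_lt with rfl | h
  · simp
  have hba : 0 < b - a := sub_pos.2 h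
  set c := (∫ s in a..b, f s) / (b - a) with hc
  have h0 : 0 ≤ ∫ s in a..b, (f s - c) ^ 2 :=
    intervalIntegral.integral_nonneg hab (fun _ _ => sq_nonneg _)
  have h1 : ∫ s in a..b, (f s - c) ^ 2
      = (∫ s in a..b, f s ^ 2) - 2 * c * (∫ s in a..b, f s) + c ^ 2 * (b - a) := by
    have : (fun s => (f s - c) ^ 2) = fun s => (f s ^ 2 - 2 * c * f s) + c ^ 2 := by
      ext s; ring
    rw [this, intervalIntegral.integral_add, intervalIntegral.integral_sub,
      intervalIntegral.integral_const_mul, intervalIntegral.integral_const]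
    · simp only [smul_eq_mul]; ring
    all_goals exact Continuous.intervalIntegrable (by fun_prop) _ _
  have h2 : (∫ s in a..b, f s) = c * (b - a) := by rw [hc]; field_simp
  rw [h1, h2] at h0
  rw [h2]
  nlinarith

lemma poincare_interval (g : ℝ → ℝ) (hg : ContDiff ℝ 1 g) (e : ℝ) (he : 0 < e) :
    ∫ s in (0:ℝ)..e, g s ^ 2 ≤
      e * (e⁻¹ * ∫ s in (0:ℝ)..e, g s) ^ 2 + e ^ 2 * ∫ s in (0:ℝ)..e, deriv g s ^ 2 := by
  have hgc : Continuous g := hg.continuous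
  have hdc : Continuous (deriv g) := hg.continuous_deriv le_rfl
  set K := ∫ s in (0:ℝ)..e, deriv g s ^ 2 with hK
  have step : ∀ r s : ℝ, 0 ≤ r → r ≤ s → s ≤ e → (g s - g r) ^ 2 ≤ e * K := by
    intro r s h0 hrs hse
    have : ∫ x in r..s, deriv g x = g s - g r :=
      intervalIntegral.integral_deriv_eq_sub
        (fun x _ => (hg.differentiable one_ne_zero).differentiableAt)
        (hdc.intervalIntegrable _ _)
    rw [← this]
    refine (cs_interval _ hdc r s hrs).trans ?_
    have h1 : ∫ x in r..s, deriv g x ^ 2 ≤ K := by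
      apply intervalIntegral.integral_mono_interval h0 hrs hse
      · exact Eventually.of_forall (fun _ => sq_nonneg _)
      · exact (hdc.pow 2).intervalIntegrable _ _
    have h2 : 0 ≤ ∫ x in r..s, deriv g x ^ 2 :=
      intervalIntegral.integral_nonneg hrs (fun _ _ => sq_nonneg _)
    exact mul_le_mul (by linarith) h1 h2 he.le
  have step' : ∀ r ∈ Set.Icc 0 e, ∀ s ∈ Set.Icc 0 e, (g s - g r) ^ 2 ≤ e * K := by
    intro r hr s hs
    rcases le_total r s with h | h
    · exact step r s hr.1 h hs.2
    · have := step s r hs.1 h hr.2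
      linarith [sq_nonneg (g s - g r), (by ring : (g s - g r)^2 = (g r - g s)^2)]
  set m := e⁻¹ * ∫ s in (0:ℝ)..e, g s with hm
  have hI : ∫ s in (0:ℝ)..e, g s = e * m := by rw [hm]; field_simp
  have step2 : ∀ s ∈ Set.Icc 0 e, (g s - m) ^ 2 ≤ e * K := by
    intro s hs
    have h1 : ∫ r in (0:ℝ)..e, (g s - g r) = e * (g s - m) := by
      rw [intervalIntegral.integral_sub (by simp) (hgc.intervalIntegrable _ _), hI]
      simp; ring
    have h2 := cs_interval (fun r => g s - g r) (by fun_prop) 0 e he.le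
    have h3 : ∫ r in (0:ℝ)..e, (g s - g r) ^ 2 ≤ ∫ r in (0:ℝ)..e, e * K := by
      apply intervalIntegral.integral_mono_on he.le
      · exact Continuous.intervalIntegrable (by fun_prop) _ _
      · simp
      · intro r hr; exact step' r hr s hs
    simp only [h1] at h2
    rw [intervalIntegral.integral_const] at h3
    simp only [smul_eq_mul, sub_zero] at h2 h3
    have : e ^ 2 * (g s - m) ^ 2 ≤ e ^ 2 * (e * K) := by nlinarith
    exact le_of_mul_le_mul_left this (by positivity)
  have h4 : ∫ s in (0:ℝ)..e, (g s - m) ^ 2 ≤ ∫ s in (0:ℝ)..e, e * K := by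
    apply intervalIntegral.integral_mono_on he.le
    · exact Continuous.intervalIntegrable (by fun_prop) _ _
    · simp
    · exact step2
  rw [intervalIntegral.integral_const] at h4
  have h5 : ∫ s in (0:ℝ)..e, (g s - m) ^ 2
      = (∫ s in (0:ℝ)..e, g s ^ 2) - 2 * m * (∫ s in (0:ℝ)..e, g s) + m ^ 2 * e := by
    have : (fun s => (g s - m) ^ 2) = fun s => (g s ^ 2 - 2 * m * g s) + m ^ 2 := by
      ext s; ring
    rw [this, intervalIntegral.integral_add, intervalIntegral.integral_sub,
      intervalIntegral.integral_const_mul, intervalIntegral.integral_const]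
    · simp only [smul_eq_mul]; ring
    all_goals exact Continuous.intervalIntegrable (by fun_prop) _ _
  rw [h5, hI] at h4
  simp only [smul_eq_mul, sub_zero] at h4
  nlinarith

section param
variable {E G : Type} [NormedAddCommGroup E] [NormedSpace ℝ E] [ProperSpace E]
  [NormedAddCommGroup G] [NormedSpace ℝ G]

lemma param_hasFDerivAt {F : Type} [NormedAddCommGroup F] [NormedSpace ℝ F] [CompleteSpace F]
    (L : E →L[ℝ] G) (v : G) (e : ℝ) (u : G → F)
    (hu : ContDiff ℝ 1 u) (x : E) :
    HasFDerivAt (fun x => ∫ s in (0:ℝ)..e, u (L x + s • v))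
      (∫ s in (0:ℝ)..e, (fderiv ℝ u (L x + s • v)).comp L) x := by
  have huc := hu.continuous
  have hdc : Continuous (fderiv ℝ u) := hu.continuous_fderiv one_ne_zero
  have hc : Continuous (fun p : E × ℝ => (fderiv ℝ u (L p.1 + p.2 • v)).comp L) := by fun_prop
  obtain ⟨C, hC⟩ := ((isCompact_closedBall x 1).prod (isCompact_uIcc (a := 0) (b := e))).exists_bound_of_continuousOn
    hc.continuousOn
  refine intervalIntegral.hasFDerivAt_integral_of_dominated_of_fderiv_le
    (F' := fun x s => (fderiv ℝ u (L x + s • v)).comp L) (bound := fun _ => C)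
    (Metric.closedBall_mem_nhds x one_pos) ?_ ?_ ?_ ?_ ?_ ?_
  · refine Eventually.of_forall (fun y => ?_)
    exact Continuous.aestronglyMeasurable (by fun_prop)
  · exact Continuous.intervalIntegrable (by fun_prop) _ _
  · exact Continuous.aestronglyMeasurable (by fun_prop)
  · refine Eventually.of_forall (fun s hs y hy => ?_)
    exact hC (y, s) ⟨hy, Set.uIoc_subset_uIcc hs⟩
  · simp
  · refine Eventually.of_forall (fun s hs y hy => ?_)
    have h1 := (hu.differentiable one_ne_zero (L y + s • v)).hasFDerivAt
    exact h1.comp y (L.hasFDerivAt.add_const _)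

lemma param_contDiff_nat (L : E →L[ℝ] G) (v : G) (e : ℝ) (n : ℕ) :
    ∀ {F : Type} [NormedAddCommGroup F] [NormedSpace ℝ F] [CompleteSpace F] (u : G → F),
    ContDiff ℝ n u → ContDiff ℝ n (fun x => ∫ s in (0:ℝ)..e, u (L x + s • v)) := by
  induction n with
  | zero =>
    intro F _ _ _ u hu
    rw [Nat.cast_zero, contDiff_zero] at hu ⊢
    exact intervalIntegral.continuous_parametric_intervalIntegral_of_continuous' (by fun_prop) _ _
  | succ n ih =>
    intro F _ _ _ u hu
    have h1 : ContDiff ℝ 1 u := hu.of_le (by simp)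
    have h2 : ContDiff ℝ n (fderiv ℝ u) := hu.fderiv_right (by simp)
    rw [Nat.cast_succ, contDiff_succ_iff_hasFDerivAt]
    refine ⟨_, ?_, fun x => param_hasFDerivAt L v e u h1 x⟩
    exact ih (fun y => (fderiv ℝ u y).comp L) (h2.clm_comp contDiff_const)

lemma param_contDiff (L : E →L[ℝ] G) (v : G) (e : ℝ) (u : G → ℝ)
    (hu : ContDiff ℝ (⊤ : ℕ∞) u) :
    ContDiff ℝ (⊤ : ℕ∞) (fun x => ∫ s in (0:ℝ)..e, u (L x + s • v)) := by
  rw [contDiff_infty] at hu ⊢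
  exact fun n => param_contDiff_nat L v e n u (hu n)
end param
/-- Projection forgetting the first coordinate. -/
def prj (d : ℕ) : Euc (d + 1) →L[ℝ] Euc d :=
  LinearMap.toContinuousLinearMap
    { toFun := fun y => WithLp.toLp 2 (fun i : Fin d => y i.succ)
      map_add' := by intros; ext; simp
      map_smul' := by intros; ext; simp }

/-- Embedding with first coordinate zero. -/
def emb (d : ℕ) : Euc d →L[ℝ] Euc (d + 1) :=
  LinearMap.toContinuousLinearMap
    { toFun := fun x => WithLp.toLp 2 (Fin.cons 0 (fun i => x i) : Fin (d+1) → ℝ)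
      map_add' := by intros; ext i; refine Fin.cases ?_ (fun j => ?_) i <;> simp
      map_smul' := by intros; ext i; refine Fin.cases ?_ (fun j => ?_) i <;> simp }

/-- The first basis vector. -/
def e0 (d : ℕ) : Euc (d + 1) := EuclideanSpace.single 0 1

/-- The cylinder over `Ω` of height `e`. -/
def cyl {d : ℕ} (Ω : Set (Euc d)) (e : ℝ) : Set (Euc (d + 1)) :=
  {y | prj d y ∈ Ω ∧ y 0 ∈ Set.Ioo 0 e}

@[simp] lemma prj_apply {d : ℕ} (y : Euc (d+1)) (i : Fin d) : prj d y i = y i.succ := rfl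
@[simp] lemma emb_apply_zero {d : ℕ} (x : Euc d) : emb d x 0 = 0 := rfl
@[simp] lemma emb_apply_succ {d : ℕ} (x : Euc d) (i : Fin d) : emb d x i.succ = x i := rfl
@[simp] lemma e0_zero {d : ℕ} : e0 d 0 = 1 := by simp [e0]
@[simp] lemma e0_succ {d : ℕ} (i : Fin d) : e0 d i.succ = 0 := by simp [e0]

@[simp] lemma prj_emb {d : ℕ} (x : Euc d) (s : ℝ) : prj d (emb d x + s • e0 d) = x := by
  ext i; simp
lemma zero_emb {d : ℕ} (x : Euc d) (s : ℝ) : (emb d x + s • e0 d) 0 = s := by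
  simp
lemma emb_single {d : ℕ} (i : Fin d) :
    emb d (EuclideanSpace.single i 1) = EuclideanSpace.single i.succ 1 := by
  ext j
  refine Fin.cases ?_ (fun j => ?_) j
  · simp [(Fin.succ_ne_zero i).symm]
  · simp
lemma prj_single_succ {d : ℕ} (i : Fin d) :
    prj d (EuclideanSpace.single i.succ 1) = EuclideanSpace.single i 1 := by
  ext j; simp
lemma prj_single_zero {d : ℕ} :
    prj d (EuclideanSpace.single 0 1) = 0 := by
  ext j; simp
lemma mem_cyl {d : ℕ} (Ω : Set (Euc d)) (e : ℝ) (x : Euc d) (s : ℝ) :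
    emb d x + s • e0 d ∈ cyl Ω e ↔ x ∈ Ω ∧ s ∈ Set.Ioo 0 e := by
  unfold cyl
  rw [Set.mem_ofPred_eq, prj_emb, zero_emb]
lemma emb_prj {d : ℕ} (y : Euc (d+1)) : emb d (prj d y) + (y 0) • e0 d = y := by
  ext i; refine Fin.cases ?_ (fun j => ?_) i <;> simp

lemma cyl_domain {d : ℕ} {Ω : Set (Euc d)} (h : IsConvexDomain Ω) {e : ℝ} (he : 0 < e) :
    IsConvexDomain (cyl Ω e) := by
  obtain ⟨⟨x, hx⟩, ho, hb, hc⟩ := h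
  have hcoord : Continuous (fun y : Euc (d+1) => y 0) := by fun_prop
  refine ⟨⟨emb d x + (e/2) • e0 d, ?_⟩, ?_, ?_, ?_⟩
  · rw [mem_cyl]; exact ⟨hx, by constructor <;> linarith⟩
  · exact (ho.preimage (prj d).continuous).inter (isOpen_Ioo.preimage hcoord)
  · obtain ⟨C, hC⟩ := hb.exists_norm_le
    refine isBounded_iff_forall_norm_le.2 ⟨‖emb d‖ * C + e * ‖e0 d‖, fun y hy => ?_⟩
    rw [← emb_prj y]
    refine (norm_add_le _ _).trans (add_le_add ?_ ?_)
    · refine ((emb d).le_opNorm _).trans ?_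
      exact mul_le_mul_of_nonneg_left (hC _ hy.1) (norm_nonneg _)
    · rw [norm_smul, Real.norm_eq_abs, abs_of_pos hy.2.1]
      exact mul_le_mul_of_nonneg_right hy.2.2.le (norm_nonneg _)
  · intro y hy z hz a b ha hb hab
    refine ⟨?_, ?_⟩
    · rw [map_add, map_smul, map_smul]
      exact hc hy.1 hz.1 ha hb hab
    · have := (convex_Ioo 0 e) hy.2 hz.2 ha hb hab
      simpa using this

lemma cyl_mono {d : ℕ} {Ω Ω' : Set (Euc d)} (h : Ω ⊆ Ω') (e : ℝ) : cyl Ω e ⊆ cyl Ω' e :=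
  fun _ hy => ⟨h hy.1, hy.2⟩

lemma norm_sq_dual {d : ℕ} (L : Euc d →L[ℝ] ℝ) :
    ‖L‖ ^ 2 = ∑ i, (L (EuclideanSpace.single i 1)) ^ 2 := by
  have := (EuclideanSpace.basisFun (Fin d) ℝ).norm_dual L
  rw [this]; simp

lemma integrableOn_bdd {n : ℕ} {Ω : Set (Euc n)} (hb : Bornology.IsBounded Ω) {f : Euc n → ℝ}
    (hf : Continuous f) : IntegrableOn f Ω :=
  (hf.continuousOn.integrableOn_compact hb.isCompact_closure).mono_set subset_closure

lemma integral_cyl {d : ℕ} {Ω : Set (Euc d)} (h : IsConvexDomain Ω) {e : ℝ} (he : 0 < e)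
    {f : Euc (d+1) → ℝ} (hf : Continuous f) :
    ∫ y in cyl Ω e, f y = ∫ x in Ω, ∫ s in (0:ℝ)..e, f (emb d x + s • e0 d) := by
  -- the measurable equivalence
  let T : Euc (d+1) ≃ᵐ ℝ × Euc d :=
    ((MeasurableEquiv.toLp 2 (Fin (d+1) → ℝ)).symm.trans
      (MeasurableEquiv.piFinSuccAbove (fun _ => ℝ) 0)).trans
      ((MeasurableEquiv.refl ℝ).prodCongr (MeasurableEquiv.toLp 2 (Fin d → ℝ)))
  have hT : MeasurePreserving T volume volume := by
    refine MeasurePreserving.trans (MeasurePreserving.trans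
      (EuclideanSpace.volume_preserving_symm_measurableEquiv_toLp _)
      (volume_preserving_piFinSuccAbove (fun _ => ℝ) 0)) ?_
    exact (MeasurePreserving.id volume).prod (PiLp.volume_preserving_toLp (Fin d))
  have hTy : ∀ y, T y = (y 0, prj d y) := by
    intro y; rfl
  have hpre : cyl Ω e = T ⁻¹' (Set.Ioo 0 e ×ˢ Ω) := by
    ext y; simp only [cyl, Set.mem_ofPred_eq, Set.mem_preimage, hTy, Set.mem_prod]; tauto
  have hfT : ∀ y, f y = (fun p : ℝ × Euc d => f (emb d p.2 + p.1 • e0 d)) (T y) := by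
    intro y; simp only [hTy]; rw [emb_prj]
  have hint : IntegrableOn f (cyl Ω e) := integrableOn_bdd (cyl_domain h he).2.2.1 hf
  have hint2 : IntegrableOn (fun p : ℝ × Euc d => f (emb d p.2 + p.1 • e0 d))
      (Set.Ioo 0 e ×ˢ Ω) (volume.prod volume) := by
    have := (hT.integrableOn_comp_preimage T.measurableEmbedding
      (f := (fun p : ℝ × Euc d => f (emb d p.2 + p.1 • e0 d))) (s := Set.Ioo 0 e ×ˢ Ω)).1
    apply this
    rw [← hpre]
    exact hint.congr_fun (fun y _ => hfT y) (cyl_domain h he).2.1.measurableSet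
  calc ∫ y in cyl Ω e, f y
      = ∫ y in T ⁻¹' (Set.Ioo 0 e ×ˢ Ω),
          (fun p : ℝ × Euc d => f (emb d p.2 + p.1 • e0 d)) (T y) := by
        rw [← hpre]; exact integral_congr_ae (Eventually.of_forall hfT)
    _ = ∫ p in Set.Ioo 0 e ×ˢ Ω, f (emb d p.2 + p.1 • e0 d) :=
        hT.setIntegral_preimage_emb T.measurableEmbedding
          (fun p : ℝ × Euc d => f (emb d p.2 + p.1 • e0 d)) (Set.Ioo 0 e ×ˢ Ω)
    _ = ∫ p in Ω ×ˢ Set.Ioo 0 e, f (emb d p.1 + p.2 • e0 d) := by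
        rw [Measure.volume_eq_prod, ← setIntegral_prod_swap]; rfl
    _ = _ := by
        rw [Measure.volume_eq_prod, setIntegral_prod]
        · simp_rw [intervalIntegral.integral_of_le he.le, integral_Ioc_eq_integral_Ioo]
        · exact hint2.swap
lemma fderiv_congr_open {n : ℕ} {Ω : Set (Euc n)} (ho : IsOpen Ω) {u v : Euc n → ℝ}
    (h : ∀ x ∈ Ω, u x = v x) : ∀ x ∈ Ω, fderiv ℝ u x = fderiv ℝ v x := by
  intro x hx
  apply Filter.EventuallyEq.fderiv_eq
  filter_upwards [ho.mem_nhds hx] with y hy using h y hy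

lemma eq_zero_of_integral_sq {n : ℕ} {Ω : Set (Euc n)} (ho : IsOpen Ω)
    (hb : Bornology.IsBounded Ω) {u : Euc n → ℝ} (hu : Continuous u)
    (h : ∫ x in Ω, u x ^ 2 = 0) : ∀ x ∈ Ω, u x = 0 := by
  have h1 := (setIntegral_eq_zero_iff_of_nonneg_ae (Eventually.of_forall fun x => sq_nonneg (u x))
    (integrableOn_bdd hb (hu.pow 2))).1 h
  have h2 : (fun x => u x ^ 2) =ᵐ[volume.restrict Ω] (fun _ => (0:ℝ)) := h1
  have h3 := Measure.eqOn_open_of_ae_eq h2 ho (hu.pow 2).continuousOn continuousOn_const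
  intro x hx
  simpa using h3 hx

lemma smooth_fderiv_cont {n : ℕ} {u : Euc n → ℝ} (hu : ContDiff ℝ (⊤ : ℕ∞) u) :
    Continuous (fderiv ℝ u) := hu.continuous_fderiv (by simp)

/-- The restriction map. -/
def rst {n : ℕ} (Ω : Set (Euc n)) : (Euc n → ℝ) →ₗ[ℝ] (Ω → ℝ) :=
  LinearMap.funLeft ℝ ℝ ((↑) : Ω → Euc n)

lemma rst_apply {n : ℕ} (Ω : Set (Euc n)) (u : Euc n → ℝ) (x : Ω) : rst Ω u x = u x := rfl

lemma rayleigh_bdd {n k : ℕ} {Ω : Set (Euc n)} (h : IsConvexDomain Ω)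
    (V : Submodule ℝ (Euc n → ℝ)) (hV : ∀ u ∈ V, ContDiff ℝ (⊤ : ℕ∞) u)
    (hr : Module.finrank ℝ (V.map (rst Ω)) = k + 1) :
    BddAbove { r : ℝ | ∃ u ∈ V, (0 < ∫ x in Ω, (u x) ^ 2) ∧ r = rayleigh Ω u } := by
  obtain ⟨-, ho, hb, -⟩ := h
  have hfin : Module.Finite ℝ (V.map (rst Ω)) := Module.finite_of_finrank_pos (by omega)
  let b := Module.finBasis ℝ (V.map (rst Ω))
  have hw : ∀ i, ∃ w ∈ V, rst Ω w = b i := fun i => (b i).2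
  choose w hwV hwb using hw
  have hwc : ∀ i, Continuous (w i) := fun i => (hV _ (hwV i)).continuous
  let uc : (Fin (Module.finrank ℝ (V.map (rst Ω))) → ℝ) → Euc n → ℝ :=
    fun c x => ∑ i, c i * w i x
  have hucc : ∀ c, Continuous (uc c) := fun c => by
    refine continuous_finsetSum _ (fun i _ => (hwc i).const_mul _)
  let Q : (Fin (Module.finrank ℝ (V.map (rst Ω))) → ℝ) → ℝ := fun c => ∫ x in Ω, uc c x ^ 2
  have hQexp : ∀ c, Q c = ∑ i, ∑ j, c i * c j * ∫ x in Ω, w i x * w j x := by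
    intro c
    have : ∀ x, uc c x ^ 2 = ∑ i, ∑ j, c i * c j * (w i x * w j x) := by
      intro x
      simp only [uc, sq, Finset.sum_mul_sum]
      refine Finset.sum_congr rfl fun i _ => Finset.sum_congr rfl fun j _ => by ring
    simp only [Q, this]
    have hi : ∀ i j, IntegrableOn (fun x => c i * c j * (w i x * w j x)) Ω := fun i j =>
      integrableOn_bdd hb (((hwc i).mul (hwc j)).const_mul _)
    rw [integral_finsetSum _ (fun i _ => integrable_finsetSum _ (fun j _ => hi i j))]
    refine Finset.sum_congr rfl fun i _ => ?_
    rw [integral_finsetSum _ (fun j _ => hi i j)]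
    refine Finset.sum_congr rfl fun j _ => ?_
    rw [integral_const_mul]
  have hQc : Continuous Q := by
    rw [show Q = _ from funext hQexp]
    fun_prop
  have hQpos : ∀ c ∈ Metric.sphere (0 : Fin (Module.finrank ℝ (V.map (rst Ω))) → ℝ) 1,
      0 < Q c := by
    intro c hc
    have h0 : 0 ≤ Q c := integral_nonneg (fun _ => sq_nonneg _)
    refine lt_of_le_of_ne h0 (fun hne => ?_)
    have hz := eq_zero_of_integral_sq ho hb (hucc c) hne.symm
    have hs : ∑ i, c i • b i = 0 := by
      apply Subtype.ext
      ext x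
      have := hz x x.2
      simp only [uc] at this
      simp only [Submodule.coe_sum, Submodule.coe_smul, ← hwb, Finset.sum_apply, Pi.smul_apply,
        rst_apply, smul_eq_mul]
      simpa using this
    have hc0 : c = 0 := by
      ext i
      exact Fintype.linearIndependent_iff.1 b.linearIndependent c hs i
    rw [hc0] at hc
    simp at hc
  obtain ⟨m, hm, hmQ⟩ := (isCompact_sphere _ _).exists_forall_le' hQc.continuousOn hQpos
  have hQhom : ∀ (a : ℝ) c, Q (a • c) = a ^ 2 * Q c := by
    intro a c
    simp only [Q, ← integral_const_mul]
    congr 1; ext x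
    have : uc (a • c) x = a * uc c x := by
      simp [uc, Finset.mul_sum, mul_assoc]
    rw [this]; ring
  have hQlow : ∀ c, m * ‖c‖ ^ 2 ≤ Q c := by
    intro c
    by_cases hc : c = 0
    · subst hc; simp [Q, uc]
    · have hn : ‖c‖ ≠ 0 := norm_ne_zero_iff.2 hc
      have h1 := hmQ (‖c‖⁻¹ • c) (by simp [norm_smul, hn])
      have h2 : Q c = ‖c‖ ^ 2 * Q (‖c‖⁻¹ • c) := by
        rw [← hQhom, smul_smul, mul_inv_cancel₀ hn, one_smul]
      rw [h2, mul_comm]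
      exact mul_le_mul_of_nonneg_left h1 (sq_nonneg _)
  set M := ∫ x in Ω, (∑ i, ‖fderiv ℝ (w i) x‖) ^ 2 with hM
  have hMnn : 0 ≤ M := integral_nonneg (fun _ => sq_nonneg _)
  have hgc : Continuous (fun x => ∑ i, ‖fderiv ℝ (w i) x‖) :=
    continuous_finsetSum _ (fun i _ => (smooth_fderiv_cont (hV _ (hwV i))).norm)
  have hfd : ∀ c x, fderiv ℝ (uc c) x = ∑ i, c i • fderiv ℝ (w i) x := by
    intro c x
    have hd : ∀ i, DifferentiableAt ℝ (w i) x := fun i =>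
      ((hV _ (hwV i)).differentiable (by simp)).differentiableAt
    simp only [uc]
    rw [fderiv_fun_sum (fun i _ => (hd i).const_mul _)]
    refine Finset.sum_congr rfl fun i _ => ?_
    rw [fderiv_const_mul (hd i)]
  have hup : ∀ c, ∫ x in Ω, ‖fderiv ℝ (uc c) x‖ ^ 2 ≤ M * ‖c‖ ^ 2 := by
    intro c
    rw [hM, mul_comm, ← integral_const_mul]
    have hcont : Continuous (fun x => ‖fderiv ℝ (uc c) x‖ ^ 2) := by
      simp only [hfd]
      refine (continuous_finsetSum _ (fun i _ => ?_)).norm.pow 2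
      exact (smooth_fderiv_cont (hV _ (hwV i))).const_smul (c i)
    refine integral_mono (integrableOn_bdd hb hcont)
      (integrableOn_bdd hb ((hgc.pow 2).const_mul _)) (fun x => ?_)
    simp only [hfd]
    rw [← mul_pow]
    refine pow_le_pow_left₀ (norm_nonneg _) ?_ 2
    refine (norm_sum_le _ _).trans ?_
    rw [Finset.mul_sum]
    refine Finset.sum_le_sum fun i _ => ?_
    rw [norm_smul]
    exact mul_le_mul_of_nonneg_right (norm_le_pi_norm c i) (norm_nonneg _)
  refine ⟨M / m, ?_⟩
  rintro r ⟨u, huV, hpos, rfl⟩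
  let c := b.repr ⟨rst Ω u, ⟨u, huV, rfl⟩⟩
  have hcu : ∀ x ∈ Ω, u x = uc c x := by
    intro x hx
    have h1 := b.sum_repr ⟨rst Ω u, ⟨u, huV, rfl⟩⟩
    have h2 := congrArg (fun f : V.map (rst Ω) => (f : Ω → ℝ) ⟨x, hx⟩) h1
    simp only [Submodule.coe_sum, Submodule.coe_smul, ← hwb, Finset.sum_apply, Pi.smul_apply,
        rst_apply, smul_eq_mul] at h2
    exact h2.symm
  have e1 : ∫ x in Ω, ‖fderiv ℝ u x‖ ^ 2 = ∫ x in Ω, ‖fderiv ℝ (uc c) x‖ ^ 2 :=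
    setIntegral_congr_fun ho.measurableSet (fun x hx => by
      simp only [fderiv_congr_open ho hcu x hx])
  have e2 : ∫ x in Ω, u x ^ 2 = Q c :=
    setIntegral_congr_fun ho.measurableSet (fun x hx => by simp only [hcu x hx])
  unfold rayleigh
  rw [div_le_iff₀ hpos, e1, e2]
  refine (hup c).trans ?_
  rw [div_mul_eq_mul_div, le_div_iff₀ hm, mul_assoc]
  refine mul_le_mul_of_nonneg_left ?_ hMnn
  rw [mul_comm]; exact hQlow c

/-- Fibre average. -/
def av {d : ℕ} (e : ℝ) (u : Euc (d+1) → ℝ) : Euc d → ℝ :=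
  fun x => e⁻¹ * ∫ s in (0:ℝ)..e, u (emb d x + s • e0 d)

lemma av_smooth {d : ℕ} (e : ℝ) {u : Euc (d+1) → ℝ} (hu : ContDiff ℝ (⊤ : ℕ∞) u) :
    ContDiff ℝ (⊤ : ℕ∞) (av e u) :=
  contDiff_const.mul (param_contDiff (emb d) (e0 d) e u hu)

lemma av_fderiv {d : ℕ} (e : ℝ) {u : Euc (d+1) → ℝ} (hu : ContDiff ℝ (⊤ : ℕ∞) u)
    (x v : Euc d) : fderiv ℝ (av e u) x v
      = e⁻¹ * ∫ s in (0:ℝ)..e, fderiv ℝ u (emb d x + s • e0 d) (emb d v) := by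
  have h1 := (param_hasFDerivAt (emb d) (e0 d) e u (hu.of_le (by simp)) x).const_mul e⁻¹
  have hc := smooth_fderiv_cont hu
  have h2 : fderiv ℝ (av e u) x = _ := h1.fderiv
  rw [h2, smul_apply, ContinuousLinearMap.intervalIntegral_apply]
  · rfl
  · exact Continuous.intervalIntegrable (by fun_prop) _ _

lemma avg_sq_le {f : ℝ → ℝ} (hf : Continuous f) {e : ℝ} (he : 0 < e) :
    e * (e⁻¹ * ∫ s in (0:ℝ)..e, f s) ^ 2 ≤ ∫ s in (0:ℝ)..e, f s ^ 2 := by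
  have h := cs_interval f hf 0 e he.le
  rw [sub_zero] at h
  have : e * (e⁻¹ * ∫ s in (0:ℝ)..e, f s) ^ 2 = e⁻¹ * (∫ s in (0:ℝ)..e, f s) ^ 2 := by
    field_simp
  rw [this, inv_mul_le_iff₀ he]
  exact h

lemma cont_fib {d : ℕ} {f : Euc (d+1) → ℝ} (hf : Continuous f) (e : ℝ) :
    Continuous (fun x : Euc d => ∫ s in (0:ℝ)..e, f (emb d x + s • e0 d)) :=
  intervalIntegral.continuous_parametric_intervalIntegral_of_continuous' (by fun_prop) _ _

lemma key3 {d : ℕ} {Ω : Set (Euc d)} (h : IsConvexDomain Ω) {e : ℝ} (he : 0 < e)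
    {u : Euc (d+1) → ℝ} (hu : ContDiff ℝ (⊤ : ℕ∞) u) :
    e * ∫ x in Ω, av e u x ^ 2 ≤ ∫ y in cyl Ω e, u y ^ 2 := by
  have huc := hu.continuous
  have hu2 : Continuous (fun y => u y ^ 2) := huc.pow 2
  have hav := (av_smooth e hu).continuous
  rw [integral_cyl h he hu2, ← integral_const_mul]
  refine integral_mono (integrableOn_bdd h.2.2.1 ((hav.pow 2).const_mul _))
    (integrableOn_bdd h.2.2.1 (cont_fib hu2 e)) (fun x => ?_)
  exact avg_sq_le (by fun_prop) he

lemma key2 {d : ℕ} {Ω : Set (Euc d)} (h : IsConvexDomain Ω) {e : ℝ} (he : 0 < e)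
    {u : Euc (d+1) → ℝ} (hu : ContDiff ℝ (⊤ : ℕ∞) u) :
    ∫ y in cyl Ω e, u y ^ 2 ≤ e * (∫ x in Ω, av e u x ^ 2)
    + e ^ 2 * ∫ y in cyl Ω e, (fderiv ℝ u y (e0 d)) ^ 2 := by
  have huc := hu.continuous
  have hu2 : Continuous (fun y => u y ^ 2) := huc.pow 2
  have hav := (av_smooth e hu).continuous
  have hdc := smooth_fderiv_cont hu
  have hdc' : Continuous (fun y => (fderiv ℝ u y (e0 d)) ^ 2) := by fun_prop
  rw [integral_cyl h he hu2, integral_cyl h he hdc',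
    ← integral_const_mul, ← integral_const_mul, ← integral_add]
  rotate_left
  · exact integrableOn_bdd h.2.2.1 ((hav.pow 2).const_mul _)
  · exact integrableOn_bdd h.2.2.1 ((cont_fib hdc' e).const_mul _)
  refine integral_mono (integrableOn_bdd h.2.2.1 (cont_fib hu2 e))
    (integrableOn_bdd h.2.2.1 (((hav.pow 2).const_mul _).add ((cont_fib hdc' e).const_mul _)))
    (fun x => ?_)
  have hg : ContDiff ℝ 1 (fun s : ℝ => u (emb d x + s • e0 d)) := by
    have : ContDiff ℝ 1 u := hu.of_le (by simp)
    fun_prop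
  have hd : ∀ s, deriv (fun s : ℝ => u (emb d x + s • e0 d)) s
      = fderiv ℝ u (emb d x + s • e0 d) (e0 d) := by
    intro s
    have h1 := (hu.differentiable (by simp) (emb d x + s • e0 d)).hasFDerivAt
    have h2 : HasDerivAt (fun s : ℝ => emb d x + s • e0 d) (e0 d) s := by
      simpa using ((hasDerivAt_id s).smul_const (e0 d)).const_add (emb d x)
    exact (h1.comp_hasDerivAt s h2).deriv
  have := poincare_interval _ hg e he
  simp only [hd] at this
  exact this

lemma key1 {d : ℕ} {Ω : Set (Euc d)} (h : IsConvexDomain Ω) {e : ℝ} (he : 0 < e)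
    {u : Euc (d+1) → ℝ} (hu : ContDiff ℝ (⊤ : ℕ∞) u) :
    e * (∫ x in Ω, ‖fderiv ℝ (av e u) x‖ ^ 2)
    + ∫ y in cyl Ω e, (fderiv ℝ u y (e0 d)) ^ 2 ≤ ∫ y in cyl Ω e, ‖fderiv ℝ u y‖ ^ 2 := by
  have hdav := smooth_fderiv_cont (av_smooth e hu)
  have hdc := smooth_fderiv_cont hu
  have hdc' : Continuous (fun y => (fderiv ℝ u y (e0 d)) ^ 2) := by fun_prop
  have hdn : Continuous (fun y => ‖fderiv ℝ u y‖ ^ 2) := by fun_prop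
  rw [integral_cyl h he hdn, integral_cyl h he hdc',
    ← integral_const_mul, ← integral_add]
  rotate_left
  · exact integrableOn_bdd h.2.2.1 ((hdav.norm.pow 2).const_mul _)
  · exact integrableOn_bdd h.2.2.1 (cont_fib hdc' e)
  refine integral_mono (integrableOn_bdd h.2.2.1 (((hdav.norm.pow 2).const_mul _).add
    (cont_fib hdc' e))) (integrableOn_bdd h.2.2.1 (cont_fib hdn e)) (fun x => ?_)
  have e1 : ∀ y, ‖fderiv ℝ u y‖ ^ 2 = (fderiv ℝ u y (e0 d)) ^ 2
      + ∑ i : Fin d, (fderiv ℝ u y (emb d (EuclideanSpace.single i 1))) ^ 2 := by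
    intro y
    rw [norm_sq_dual, Fin.sum_univ_succ]
    simp only [emb_single, e0]
  simp only [e1]
  rw [intervalIntegral.integral_add, intervalIntegral.integral_finsetSum, add_comm]
  rotate_left
  · exact fun i _ => Continuous.intervalIntegrable (by fun_prop) _ _
  · exact Continuous.intervalIntegrable (by fun_prop) _ _
  · exact Continuous.intervalIntegrable (by fun_prop) _ _
  refine add_le_add le_rfl ?_
  rw [norm_sq_dual, Finset.mul_sum]
  refine Finset.sum_le_sum fun i _ => ?_
  rw [av_fderiv e hu]
  exact avg_sq_le (by fun_prop) he

lemma finrank_map_inj {M N : Type*} [AddCommGroup M] [Module ℝ M] [AddCommGroup N] [Module ℝ N]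
    (f : M →ₗ[ℝ] N) (hf : Function.Injective f) (p : Submodule ℝ M) :
    Module.finrank ℝ (p.map f) = Module.finrank ℝ p :=
  (Submodule.equivMapOfInjective f hf p).finrank_eq.symm

/-- The set of admissible min-max values. -/
def adm {d : ℕ} (k : ℕ) (Ω : Set (Euc d)) : Set ℝ :=
  { t : ℝ | ∃ V : Submodule ℝ (Euc d → ℝ),
    (∀ u ∈ V, ContDiff ℝ (⊤ : ℕ∞) u) ∧
    Module.finrank ℝ (V.map (rst Ω)) = k + 1 ∧
    t = sSup { r : ℝ | ∃ u ∈ V, (0 < ∫ x in Ω, (u x) ^ 2) ∧ r = rayleigh Ω u } }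

lemma neumann_eq {d : ℕ} (k : ℕ) (Ω : Set (Euc d)) : neumannEigenvalue k Ω = sInf (adm k Ω) := rfl

lemma rayleigh_nonneg {d : ℕ} (Ω : Set (Euc d)) (u : Euc d → ℝ) : 0 ≤ rayleigh Ω u :=
  div_nonneg (integral_nonneg fun _ => sq_nonneg _) (integral_nonneg fun _ => sq_nonneg _)

lemma adm_nonneg {d : ℕ} (k : ℕ) (Ω : Set (Euc d)) : ∀ t ∈ adm k Ω, 0 ≤ t := by
  rintro t ⟨V, -, -, rfl⟩
  apply Real.sSup_nonneg
  rintro r ⟨u, -, -, rfl⟩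
  exact rayleigh_nonneg Ω u

lemma neumann_nonneg {d : ℕ} (k : ℕ) (Ω : Set (Euc d)) : 0 ≤ neumannEigenvalue k Ω :=
  Real.sInf_nonneg (adm_nonneg k Ω)

lemma adm_nonempty {d : ℕ} (k : ℕ) (hd : 0 < d) {Ω : Set (Euc d)} (h : IsConvexDomain Ω) :
    (adm k Ω).Nonempty := by
  let i0 : Fin d := ⟨0, hd⟩
  let Φ : Polynomial ℝ →ₗ[ℝ] (Euc d → ℝ) :=
    { toFun := fun p x => p.eval (x i0)
      map_add' := by intros; ext; simp
      map_smul' := by intros; ext; simp }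
  refine ⟨_, (Polynomial.degreeLT ℝ (k+1)).map Φ, ?_, ?_, rfl⟩
  · rintro u ⟨p, -, rfl⟩
    have h1 : ContDiff ℝ (⊤ : ℕ∞) (fun t : ℝ => p.eval t) := by
      simpa using p.contDiff_aeval (𝕜 := ℝ) (n := (⊤ : ℕ∞))
    have h2 : ContDiff ℝ (⊤ : ℕ∞) (fun x : Euc d => x i0) := by fun_prop
    exact h1.comp h2
  · rw [← Submodule.map_comp]
    have hinj : Function.Injective ((rst Ω).comp Φ) := by
      rw [← LinearMap.ker_eq_bot, LinearMap.ker_eq_bot']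
      intro p hp
      obtain ⟨⟨x, hx⟩, ho, -, -⟩ := h
      have hc : Continuous (fun t : ℝ => x + t • (EuclideanSpace.single i0 (1:ℝ) : Euc d)) := by
        fun_prop
      have hn : (fun t : ℝ => x + t • (EuclideanSpace.single i0 (1:ℝ) : Euc d)) ⁻¹' Ω ∈ nhds 0 :=
        hc.continuousAt.preimage_mem_nhds (by simpa using ho.mem_nhds hx)
      have hinf := infinite_of_mem_nhds (0:ℝ) hn
      have hinf2 := hinf.image (f := fun t => x i0 + t) (fun a _ b _ hab => by simpa using hab)
      refine Polynomial.eq_zero_of_infinite_isRoot p (hinf2.mono ?_)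
      rintro _ ⟨t, ht, rfl⟩
      have := congrFun hp ⟨_, ht⟩
      simp only [LinearMap.comp_apply, rst_apply, Φ, LinearMap.coe_mk, AddHom.coe_mk] at this
      simpa [Polynomial.IsRoot] using this
    rw [finrank_map_inj _ hinj]
    have := (Polynomial.degreeLTEquiv ℝ (k+1)).finrank_eq
    simpa using this

lemma rayleigh_pull {d : ℕ} {Ω : Set (Euc d)} (h : IsConvexDomain Ω) {e : ℝ} (he : 0 < e)
    {u : Euc d → ℝ} (hu : ContDiff ℝ (⊤ : ℕ∞) u) :
    (∫ y in cyl Ω e, u (prj d y) ^ 2 = e * ∫ x in Ω, u x ^ 2) ∧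
    rayleigh (cyl Ω e) (fun y => u (prj d y)) = rayleigh Ω u := by
  have huc := hu.continuous
  have hdc := smooth_fderiv_cont hu
  have h1 : ∫ y in cyl Ω e, u (prj d y) ^ 2 = e * ∫ x in Ω, u x ^ 2 := by
    rw [integral_cyl h he (f := fun y => u (prj d y) ^ 2) (by fun_prop)]
    simp only [prj_emb, intervalIntegral.integral_const, smul_eq_mul, sub_zero]
    rw [integral_const_mul]
  have h2 : ∫ y in cyl Ω e, ‖fderiv ℝ (fun y => u (prj d y)) y‖ ^ 2
      = e * ∫ x in Ω, ‖fderiv ℝ u x‖ ^ 2 := by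
    have hn : ∀ y, ‖fderiv ℝ (fun y => u (prj d y)) y‖ ^ 2 = ‖fderiv ℝ u (prj d y)‖ ^ 2 := by
      intro y
      have h3 : fderiv ℝ (fun y => u (prj d y)) y = (fderiv ℝ u (prj d y)).comp (prj d) :=
        ((hu.differentiable (by simp) (prj d y)).hasFDerivAt.comp y (prj d).hasFDerivAt).fderiv
      rw [h3, norm_sq_dual, norm_sq_dual, Fin.sum_univ_succ]
      simp [prj_single_zero, prj_single_succ]
    simp only [hn]
    rw [integral_cyl h he (f := fun y => ‖fderiv ℝ u (prj d y)‖ ^ 2) (by fun_prop)]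
    simp only [prj_emb, intervalIntegral.integral_const, smul_eq_mul, sub_zero]
    rw [integral_const_mul]
  refine ⟨h1, ?_⟩
  unfold rayleigh
  rw [h1, h2, mul_div_mul_left _ _ he.ne']

lemma adm_subset {d : ℕ} (k : ℕ) {Ω : Set (Euc d)} (h : IsConvexDomain Ω) {e : ℝ} (he : 0 < e) :
    adm k Ω ⊆ adm k (cyl Ω e) := by
  rintro t ⟨V, hV, hr, rfl⟩
  refine ⟨V.map (LinearMap.funLeft ℝ ℝ (prj d)), ?_, ?_, ?_⟩
  · rintro _ ⟨u, hu, rfl⟩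
    exact (hV u hu).comp (prj d).contDiff
  · let q : cyl Ω e → Ω := fun y => ⟨prj d y, y.2.1⟩
    have hq : Function.Surjective q := by
      rintro ⟨x, hx⟩
      refine ⟨⟨emb d x + (e/2) • e0 d, (mem_cyl _ _ _ _).2 ⟨hx, by constructor <;> linarith⟩⟩, ?_⟩
      apply Subtype.ext
      exact prj_emb _ _
    have hcomm : (rst (cyl Ω e)).comp (LinearMap.funLeft ℝ ℝ (prj d))
        = (LinearMap.funLeft ℝ ℝ q).comp (rst Ω) := rfl
    rw [← Submodule.map_comp, hcomm, Submodule.map_comp,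
      finrank_map_inj _ (LinearMap.funLeft_injective_of_surjective ℝ ℝ q hq)]
    exact hr
  · congr 1
    ext r
    constructor
    · rintro ⟨u, hu, hp, rfl⟩
      obtain ⟨h1, h2⟩ := rayleigh_pull h he (hV u hu)
      refine ⟨fun y => u (prj d y), ⟨u, hu, rfl⟩, ?_, h2.symm⟩
      rw [h1]; positivity
    · rintro ⟨_, ⟨u, hu, rfl⟩, hp, rfl⟩
      obtain ⟨h1, h2⟩ := rayleigh_pull h he (hV u hu)
      refine ⟨u, hu, ?_, h2⟩
      have hp' : 0 < ∫ y in cyl Ω e, u (prj d y) ^ 2 := hp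
      rw [h1] at hp'
      exact (mul_pos_iff_of_pos_left he).1 hp'

lemma upper {d : ℕ} (k : ℕ) (hd : 0 < d) {Ω : Set (Euc d)} (h : IsConvexDomain Ω)
    {e : ℝ} (he : 0 < e) : neumannEigenvalue k (cyl Ω e) ≤ neumannEigenvalue k Ω :=
  csInf_le_csInf ⟨0, fun t ht => adm_nonneg k _ t ht⟩ (adm_nonempty k hd h) (adm_subset k h he)

lemma lower_step {d : ℕ} (k : ℕ) {Ω : Set (Euc d)} (h : IsConvexDomain Ω)
    {e : ℝ} (he : 0 < e) (t : ℝ) (ht : t ∈ adm k (cyl Ω e)) (hte : e ^ 2 * t < 1) :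
    ∃ t' ∈ adm k Ω, t' ≤ t := by
  have ht0 := adm_nonneg k _ t ht
  obtain ⟨V, hV, hr, htV⟩ := ht
  have hcd := cyl_domain h he
  have hbdd := rayleigh_bdd hcd V hV hr
  -- the Rayleigh bound
  have hray : ∀ u ∈ V, 0 < ∫ y in cyl Ω e, u y ^ 2 →
      ∫ y in cyl Ω e, ‖fderiv ℝ u y‖ ^ 2 ≤ t * ∫ y in cyl Ω e, u y ^ 2 := by
    intro u hu hp
    rw [← div_le_iff₀ hp, htV]
    exact le_csSup hbdd ⟨u, hu, hp, rfl⟩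
  let A : V →ₗ[ℝ] (Euc d → ℝ) :=
    { toFun := fun u => av e u.1
      map_add' := by
        intro u v
        have hu := (hV u.1 u.2).continuous
        have hv := (hV v.1 v.2).continuous
        ext x
        simp only [av, Submodule.coe_add, Pi.add_apply]
        rw [intervalIntegral.integral_add, mul_add]
        · exact Continuous.intervalIntegrable (by fun_prop) _ _
        · exact Continuous.intervalIntegrable (by fun_prop) _ _
      map_smul' := by
        intro c u
        ext x
        simp only [av, Submodule.coe_smul, Pi.smul_apply, smul_eq_mul, RingHom.id_apply,
          intervalIntegral.integral_const_mul]
        ring }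
  have hA : ∀ u : V, A u = av e u.1 := fun _ => rfl
  have hS : ∀ u : Euc (d+1) → ℝ, 0 ≤ ∫ y in cyl Ω e, (fderiv ℝ u y (e0 d)) ^ 2 :=
    fun u => integral_nonneg fun _ => sq_nonneg _
  have hG : ∀ u : Euc (d+1) → ℝ, 0 ≤ ∫ x in Ω, ‖fderiv ℝ (av e u) x‖ ^ 2 :=
    fun u => integral_nonneg fun _ => sq_nonneg _
  have hker : LinearMap.ker ((rst Ω).comp A) = LinearMap.ker ((rst (cyl Ω e)).comp V.subtype) := by
    ext u
    rw [LinearMap.mem_ker, LinearMap.mem_ker]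
    have hus := hV u.1 u.2
    constructor
    · intro hu
      have hz : ∀ x ∈ Ω, av e u.1 x = 0 := fun x hx => congrFun hu ⟨x, hx⟩
      have hM : ∫ x in Ω, av e u.1 x ^ 2 = 0 := by
        rw [setIntegral_congr_fun h.2.1.measurableSet
          (g := fun _ => (0:ℝ)) (fun x hx => by simp [hz x hx])]
        simp
      have k1 := key1 h he hus
      have k2 := key2 h he hus
      rw [hM] at k2
      have hN : 0 ≤ ∫ y in cyl Ω e, u.1 y ^ 2 := integral_nonneg fun _ => sq_nonneg _
      have hN0 : ∫ y in cyl Ω e, u.1 y ^ 2 = 0 := by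
        by_contra hne
        have hp := lt_of_le_of_ne hN (Ne.symm hne)
        have hq := hray u.1 u.2 hp
        have h1 : ∫ y in cyl Ω e, (fderiv ℝ u.1 y (e0 d)) ^ 2
            ≤ t * ∫ y in cyl Ω e, u.1 y ^ 2 := by
          have := mul_nonneg he.le (hG u.1)
          linarith
        have h2 := mul_le_mul_of_nonneg_left h1 (sq_nonneg e)
        nlinarith
      ext y
      exact eq_zero_of_integral_sq hcd.2.1 hcd.2.2.1 hus.continuous hN0 y y.2
    · intro hu
      have hz : ∀ y ∈ cyl Ω e, u.1 y = 0 := fun y hy => congrFun hu ⟨y, hy⟩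
      ext x
      change av e u.1 x = 0
      unfold av
      have : ∫ s in (0:ℝ)..e, u.1 (emb d x + s • e0 d) = 0 := by
        rw [intervalIntegral.integral_of_le he.le, integral_Ioc_eq_integral_Ioo]
        rw [setIntegral_congr_fun measurableSet_Ioo (g := fun _ => (0:ℝ))
          (fun s hs => hz _ ((mem_cyl _ _ _ _).2 ⟨x.2, hs⟩))]
        simp
      rw [this, mul_zero]
  refine ⟨_, ⟨LinearMap.range A, ?_, ?_, rfl⟩, ?_⟩
  · rintro _ ⟨u, rfl⟩
    exact av_smooth e (hV u.1 u.2)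
  · have h1 : (LinearMap.range A).map (rst Ω) = LinearMap.range ((rst Ω).comp A) :=
      (LinearMap.range_comp _ _).symm
    have h2 : V.map (rst (cyl Ω e)) = LinearMap.range ((rst (cyl Ω e)).comp V.subtype) := by
      rw [LinearMap.range_comp, Submodule.range_subtype]
    rw [h1, ← ((rst Ω).comp A).quotKerEquivRange.finrank_eq, hker,
      ((rst (cyl Ω e)).comp V.subtype).quotKerEquivRange.finrank_eq, ← h2]
    exact hr
  · refine Real.sSup_le ?_ ht0
    rintro r ⟨_, ⟨u, rfl⟩, hp, rfl⟩
    rw [hA] at hp ⊢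
    have hus := hV u.1 u.2
    have k1 := key1 h he hus
    have k2 := key2 h he hus
    have k3 := key3 h he hus
    have hN : 0 < ∫ y in cyl Ω e, u.1 y ^ 2 := lt_of_lt_of_le (mul_pos he hp) k3
    have hq := hray u.1 u.2 hN
    have hs := hS u.1
    unfold rayleigh
    rw [div_le_iff₀ hp]
    refine le_of_mul_le_mul_left ?_ he
    have k2' := mul_le_mul_of_nonneg_left k2 ht0
    nlinarith

lemma lower {d : ℕ} (k : ℕ) (hd : 0 < d) {Ω : Set (Euc d)} (h : IsConvexDomain Ω)
    {e : ℝ} (he : 0 < e) (hm : e ^ 2 * neumannEigenvalue k Ω ≤ 1) :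
    neumannEigenvalue k Ω ≤ neumannEigenvalue k (cyl Ω e) := by
  rw [neumann_eq k (cyl Ω e)]
  refine le_csInf ((adm_nonempty k hd h).mono (adm_subset k h he)) (fun t ht => ?_)
  by_contra! hlt
  obtain ⟨t', ht', hle⟩ := lower_step k h he t ht (by
    have : 0 < e ^ 2 := by positivity
    nlinarith)
  have : neumannEigenvalue k Ω ≤ t' := csInf_le ⟨0, fun t ht => adm_nonneg k _ t ht⟩ ht'
  linarith

/-- the optimal constants are non-increasing in the dimension:
`α_{k,d} ≥ α_{k,d+1}`. -/
theorem alpha_antitone_in_dimension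
    (k d : ℕ) (hk : 1 ≤ k) (hd : 2 ≤ d) :
    alphaConst k d ≥ alphaConst k (d + 1) := by
  have hd0 : 0 < d := by omega
  unfold alphaConst
  refine le_csInf ?_ ?_
  · refine ⟨_, Metric.ball 0 1, Metric.ball 0 1, ?_, ?_, subset_rfl, rfl⟩ <;>
    exact ⟨⟨0, by simp⟩, Metric.isOpen_ball, Metric.isBounded_ball, convex_ball _ _⟩
  · rintro r ⟨Ω₁, Ω₂, h1, h2, hsub, rfl⟩
    have hm := neumann_nonneg k Ω₂
    set m := neumannEigenvalue k Ω₂ with hmdef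
    have he : 0 < 1 / (1 + m) := by positivity
    have hem : (1 / (1 + m)) ^ 2 * m ≤ 1 := by
      rw [div_pow, one_pow, div_mul_eq_mul_div, div_le_one (by positivity)]
      nlinarith
    have heq : neumannEigenvalue k (cyl Ω₂ (1 / (1 + m))) = m :=
      le_antisymm (upper k hd0 h2 he) (lower k hd0 h2 he hem)
    refine le_trans (csInf_le (a := neumannEigenvalue k (cyl Ω₁ (1 / (1 + m))) /
      neumannEigenvalue k (cyl Ω₂ (1 / (1 + m)))) ⟨0, ?_⟩ ⟨cyl Ω₁ (1 / (1 + m)), cyl Ω₂ (1 / (1 + m)), cyl_domain h1 he,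
      cyl_domain h2 he, cyl_mono hsub _, rfl⟩) ?_
    · rintro r ⟨Ω, Ω', -, -, -, rfl⟩
      exact div_nonneg (neumann_nonneg _ _) (neumann_nonneg _ _)
    · rw [heq]
      exact div_le_div_of_nonneg_right (upper k hd0 h1 he) hm

end
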